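/- arXiv:2006.12319 — 2 statements merged into one kernel-verified Lean document; each statement's English description precedes it below -/
import Mathlib

section
/- Let p be a prime and let α, β be positive natural numbers with α·(β+1) ≤ p-1. Then the set of residues a ∈ 𝔽_p \ {0} for which there exist integers x with 1 ≤ x ≤ α and y with 1 ≤ y ≤ β such that a·x ≡ y (mod p) or a·x ≡ -y (mod p) has at least α·(β+1) elements. -/
open Polynomial in
/-- A bivariate polynomial has total degree at most `d`. -/
def TVTot {F : Type*} [Field F] (d : ℕ) (q : F[X][X]) : Prop :=
  ∀ j, (q.coeff j).degree + (j : WithBot ℕ) ≤ (d : WithBot ℕ)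

open Polynomial in
theorem TVTot.coeff_bound {F : Type*} [Field F] {d : ℕ} {q : F[X][X]} (h : TVTot d q) (j : ℕ)
    (h0 : q.coeff j ≠ 0) : (q.coeff j).natDegree + j ≤ d := by
  have := h j
  rw [degree_eq_natDegree h0] at this
  exact_mod_cast this

open Polynomial in
theorem TVTot.of_bound {F : Type*} [Field F] {d : ℕ} {q : F[X][X]}
    (h : ∀ j, q.coeff j ≠ 0 → (q.coeff j).natDegree + j ≤ d) : TVTot d q := by
  intro j
  by_cases h0 : q.coeff j = 0
  · simp [h0]
  · rw [degree_eq_natDegree h0]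
    exact_mod_cast h j h0

open Polynomial in
theorem TVTot.sub {F : Type*} [Field F] {d : ℕ} {q r : F[X][X]} (hq : TVTot d q)
    (hr : TVTot d r) : TVTot d (q - r) := by
  intro j
  rw [coeff_sub]
  have h1 := degree_sub_le (q.coeff j) (r.coeff j)
  rcases le_max_iff.1 h1 with h | h
  · exact (add_le_add_left h _).trans (hq j)
  · exact (add_le_add_left h _).trans (hr j)

open Polynomial in
theorem TVTot.X_mul {F : Type*} [Field F] {d : ℕ} {q : F[X][X]} (hq : TVTot d q) :
    TVTot (d + 1) (X * q) := by
  apply TVTot.of_bound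
  intro j h0
  cases j with
  | zero => simp at h0
  | succ j =>
    rw [coeff_X_mul] at h0 ⊢
    have := hq.coeff_bound j h0
    omega

open Polynomial in
theorem TVTot.C_mul {F : Type*} [Field F] {d e k : ℕ} {q : F[X][X]} (hq : TVTot d q) (c : F[X])
    (hc : c ≠ 0 → c.natDegree + e ≤ k) (hde : d ≤ e) : TVTot k (C c * q) := by
  apply TVTot.of_bound
  intro j h0
  rw [coeff_C_mul] at h0 ⊢
  have h1 := hq.coeff_bound j (right_ne_zero_of_mul h0)
  have h2 := hc (left_ne_zero_of_mul h0)
  have := natDegree_mul_le (p := c) (q := q.coeff j)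
  omega

open Polynomial in
theorem TVTot.prod {F : Type*} [Field F] {ι : Type*} (s : Finset ι) (l : ι → F[X])
    (hl : ∀ i, (l i).natDegree ≤ 1) : TVTot s.card (∏ i ∈ s, (X - C (l i))) := by
  classical
  induction s using Finset.induction_on with
  | empty =>
    apply TVTot.of_bound
    intro j h0
    simp only [Finset.prod_empty, coeff_one] at h0 ⊢
    split_ifs at h0 ⊢ with h
    · simp [h]
    · simp at h0
  | insert i s hi ih =>
    rw [Finset.prod_insert hi, Finset.card_insert_of_notMem hi, sub_mul]
    refine ih.X_mul.sub (ih.C_mul (e := s.card) _ ?_ le_rfl)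
    intro _
    have := hl i
    omega

open Polynomial in
theorem tv_rem {F : Type*} [Field F] {n : ℕ} (hn : 0 < n) {H : F[X][X]} (hH : H.Monic)
    (hdeg : H.natDegree = n) (hT : TVTot n H) (k : ℕ) :
    ∃ r : F[X][X], TVTot k r ∧ r.degree < n ∧ H ∣ X ^ k - r := by
  induction k with
  | zero =>
    refine ⟨1, ?_, ?_, by simp⟩
    · simpa using TVTot.prod (F := F) (∅ : Finset ℕ) (fun _ => 0) (by simp)
    · rw [degree_one]; exact_mod_cast hn
  | succ k ih =>
    obtain ⟨r, h1, h2, h3⟩ := ih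
    obtain ⟨m, rfl⟩ : ∃ m, n = m + 1 := ⟨n - 1, by omega⟩
    refine ⟨X * r - C (r.coeff m) * H, ?_, ?_, ?_⟩
    · refine h1.X_mul.sub (hT.C_mul (e := m + 1) _ ?_ le_rfl)
      intro h0
      have := h1.coeff_bound m h0
      omega
    · rw [degree_lt_iff_coeff_zero] at h2 ⊢
      intro j hj
      obtain ⟨i, rfl⟩ : ∃ i, j = i + 1 := ⟨j - 1, by omega⟩
      rw [coeff_sub, coeff_X_mul, coeff_C_mul]
      by_cases hi : i = m
      · subst hi
        have : H.coeff (i + 1) = 1 := by rw [← hdeg]; exact hH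
        rw [this]; ring
      · rw [h2 i (by omega), coeff_eq_zero_of_natDegree_lt (by omega : H.natDegree < i + 1)]
        simp
    · have : X ^ (k + 1) - (X * r - C (r.coeff m) * H)
          = X * (X ^ k - r) + C (r.coeff m) * H := by ring
      rw [this]
      exact dvd_add (h3.mul_left _) (dvd_mul_left _ _)

open Polynomial in
theorem tv_core (p : ℕ) [Fact p.Prime] (α β : ℕ) (hα : 0 < α) (hβ : 0 < β) (hβp : β < p)
    (hnp : (α + 1) * (β + 1) ≤ p) (M : Finset (ZMod p))
    (hM : ∀ m ∈ M, Set.InjOn (fun q : ℕ × ℕ => (q.2 : ZMod p) - q.1 * m)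
      (Finset.range (α + 1) ×ˢ Finset.range (β + 1) : Finset (ℕ × ℕ))) :
    α * (β + 1) + M.card + 1 ≤ p := by
  classical
  set s : Finset (ℕ × ℕ) := Finset.range (α + 1) ×ˢ Finset.range (β + 1) with hs
  set n := (α + 1) * (β + 1) with hn
  have hcard : s.card = n := by simp [hs, hn]
  have hn2 : 4 ≤ n := by rw [hn]; nlinarith
  set l : ℕ × ℕ → (ZMod p)[X] := fun q => C (q.2 : ZMod p) - C (q.1 : ZMod p) * X with hl
  set H : (ZMod p)[X][X] := ∏ i ∈ s, (X - C (l i)) with hH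
  have hmon : H.Monic := monic_prod_of_monic _ _ (fun i _ => monic_X_sub_C _)
  have hdeg : H.natDegree = n := by
    rw [hH, natDegree_prod_of_monic _ _ (fun i _ => monic_X_sub_C _)]
    simp [hcard]
  have hT : TVTot n H := by
    rw [← hcard]
    apply TVTot.prod
    intro i
    refine (natDegree_sub_le _ _).trans (max_le (by simp) ?_)
    exact (natDegree_C_mul_le _ _).trans natDegree_X_le
  obtain ⟨r, hr1, hr2, hr3⟩ := tv_rem (by omega) hmon hdeg hT p
  have hmapH : ∀ m : ZMod p, H.map (evalRingHom m) =
      ∏ i ∈ s, (X - C ((i.2 : ZMod p) - i.1 * m)) := by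
    intro m
    rw [hH, Polynomial.map_prod]
    refine Finset.prod_congr rfl fun i _ => ?_
    simp [hl]
  have hdvd : ∀ m : ZMod p, (∏ i ∈ s, (X - C ((i.2 : ZMod p) - i.1 * m))) ∣
      X ^ p - r.map (evalRingHom m) := by
    intro m
    rw [← hmapH]
    simpa using Polynomial.map_dvd (evalRingHom m) hr3
  have hrm : ∀ m ∈ M, r.map (evalRingHom m) = X := by
    intro m hm
    have h1 : (∏ i ∈ s, (X - C ((i.2 : ZMod p) - i.1 * m))) ∣ (X ^ p - X : (ZMod p)[X]) := by
      apply Finset.prod_dvd_of_coprime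
      · intro i hi j hj hij
        refine isCoprime_X_sub_C_of_isUnit_sub ?_
        rw [isUnit_iff_ne_zero, sub_ne_zero]
        exact fun h => hij (hM m hm hi hj h)
      · intro i _
        rw [dvd_iff_isRoot]
        simp
    have h2 := dvd_sub h1 (hdvd m)
    have h3 : (X ^ p - X - (X ^ p - r.map (evalRingHom m)) : (ZMod p)[X])
        = r.map (evalRingHom m) - X := by ring
    rw [h3, ← hmapH] at h2
    rw [← sub_eq_zero]
    refine eq_zero_of_dvd_of_degree_lt h2 ?_
    rw [hmon.degree_map, degree_eq_natDegree hmon.ne_zero, hdeg]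
    refine (degree_sub_le _ _).trans_lt (max_lt ((degree_map_le).trans_lt hr2) ?_)
    rw [degree_X]; exact_mod_cast (by omega : 1 < n)
  have hcoef : ∀ j, j ≠ 1 → p < M.card + j → r.coeff j = 0 := by
    intro j hj hpj
    by_contra h0
    have hb := hr1.coeff_bound j h0
    refine h0 (eq_zero_of_natDegree_lt_card_of_eval_eq_zero' _ M ?_ (by omega))
    intro m hm
    have := congrArg (fun q => q.coeff j) (hrm m hm)
    simpa [coeff_X, hj.symm] using this
  set r0 := r.map (evalRingHom (0 : ZMod p)) with hr0
  have hd0 : (∏ b ∈ Finset.range (β + 1), (X - C (b : ZMod p))) ^ (α + 1) ∣ X ^ p - r0 := by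
    have := hdvd 0
    rw [hs, Finset.prod_product] at this
    simpa using this
  have hder : (∏ b ∈ Finset.range (β + 1), (X - C (b : ZMod p))) ^ α ∣ derivative r0 := by
    obtain ⟨w, hw⟩ := hd0
    have h1 := congrArg derivative hw
    simp only [derivative_sub, derivative_X_pow, CharP.cast_eq_zero, map_zero, zero_mul, zero_sub,
      derivative_mul, derivative_pow] at h1
    rw [← dvd_neg, h1]
    simp only [Nat.add_sub_cancel]
    refine dvd_add ?_ ?_
    · exact Dvd.dvd.mul_right (Dvd.dvd.mul_right (dvd_mul_left _ _) _) _
    · exact Dvd.dvd.mul_right (pow_dvd_pow _ (by omega)) _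
  have hr0deg : ∀ j, n ≤ j → r0.coeff j = 0 := by
    intro j hj
    rw [degree_lt_iff_coeff_zero] at hr2
    rw [hr0, coeff_map, hr2 j hj, map_zero]
  have hne : derivative r0 ≠ 0 := by
    intro hz
    have hc : r0 = C (r0.coeff 0) := by
      ext j
      cases j with
      | zero => simp
      | succ j =>
        rw [coeff_C_succ]
        by_cases hj : n ≤ j + 1
        · exact hr0deg _ hj
        · have h1 := congrArg (fun q => q.coeff j) hz
          simp only [coeff_derivative, coeff_zero, mul_eq_zero] at h1
          refine h1.resolve_right ?_
          intro h2
          have h3 : ((j + 1 : ℕ) : ZMod p) = 0 := by exact_mod_cast h2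
          rw [ZMod.natCast_eq_zero_iff] at h3
          have := Nat.le_of_dvd (by omega) h3
          omega
    have hroot : ∀ b ∈ Finset.range (β + 1), (b : ZMod p) = r0.coeff 0 := by
      intro b hb
      have h1 : (X - C (b : ZMod p)) ∣ X ^ p - r0 :=
        ((Finset.dvd_prod_of_mem (fun b : ℕ => X - C (b : ZMod p)) hb).trans
          (dvd_pow_self _ (by omega))).trans hd0
      rw [dvd_iff_isRoot, hc] at h1
      simpa [sub_eq_zero] using h1
    have e0 := hroot 0 (by simp)
    have e1 := hroot 1 (by simp; omega)
    rw [← e0] at e1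
    simp at e1
  have hle := natDegree_le_of_dvd hder hne
  have hdp : ((∏ b ∈ Finset.range (β + 1), (X - C (b : ZMod p))) ^ α).natDegree
      = α * (β + 1) := by
    rw [natDegree_pow, natDegree_prod_of_monic _ _ (fun i _ => monic_X_sub_C _)]
    simp only [natDegree_X_sub_C, Finset.sum_const, Finset.card_range, smul_eq_mul, mul_one]
  rw [hdp] at hle
  set d := (derivative r0).natDegree with hd
  have hlead : (derivative r0).coeff d ≠ 0 := by
    rw [hd]; exact leadingCoeff_ne_zero.2 hne
  rw [coeff_derivative] at hlead
  have h5 : r.coeff (d + 1) ≠ 0 := by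
    intro h
    apply left_ne_zero_of_mul hlead
    rw [hr0, coeff_map, h, map_zero]
  by_contra hcon
  have hdpos : 0 < d := lt_of_lt_of_le (Nat.mul_pos hα (Nat.succ_pos β)) hle
  exact h5 (hcoef (d + 1) (by omega) (by omega))

/-- Main theorem: for a prime `p` and positive `α, β` with `α(β+1) ≤ p - 1`,
there are at least `α(β+1)` nonzero residues `a` mod `p` admitting `x ∈ {1,…,α}`,
`y ∈ {1,…,β}` with `a·x ≡ ±y (mod p)`. -/
theorem thue_vinogradov_extension (p : ℕ) [Fact p.Prime] (α β : ℕ)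
    (hα : 0 < α) (hβ : 0 < β) (hαβ : α * (β + 1) ≤ p - 1) :
    α * (β + 1) ≤
      Set.ncard {a : ZMod p | a ≠ 0 ∧ ∃ x y : ℕ, 1 ≤ x ∧ x ≤ α ∧ 1 ≤ y ∧ y ≤ β ∧
        (a * (x : ZMod p) = (y : ZMod p) ∨ a * (x : ZMod p) = -(y : ZMod p))} := by
  classical
  have hp : p.Prime := Fact.out
  have hp2 := hp.two_le
  have hβp : β < p := by nlinarith [Nat.sub_add_cancel hp.one_le]
  have hαp : α < p := by nlinarith [Nat.sub_add_cancel hp.one_le]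
  set S : Set (ZMod p) := {a : ZMod p | a ≠ 0 ∧ ∃ x y : ℕ, 1 ≤ x ∧ x ≤ α ∧ 1 ≤ y ∧ y ≤ β ∧
        (a * (x : ZMod p) = (y : ZMod p) ∨ a * (x : ZMod p) = -(y : ZMod p))} with hS
  have hcast : ∀ k : ℕ, 0 < k → k < p → (k : ZMod p) ≠ 0 := by
    intro k h1 h2 h3
    rw [ZMod.natCast_eq_zero_iff] at h3
    exact absurd (Nat.le_of_dvd h1 h3) (by omega)
  have key : ∀ m : ZMod p, m ≠ 0 → m ∉ S → ∀ a a' b b' : ℕ, a' < a → a ≤ α → b ≤ β → b' ≤ β →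
      (b : ZMod p) - a * m = b' - a' * m → False := by
    intro m hm hmS a a' b b' haa ha hb hb' h
    obtain ⟨x, rfl⟩ := Nat.exists_eq_add_of_lt haa
    push_cast at h
    rcases lt_trichotomy b b' with hbb | hbb | hbb
    · obtain ⟨y, rfl⟩ := Nat.exists_eq_add_of_lt hbb
      push_cast at h
      refine hmS ⟨hm, x + 1, y + 1, by omega, by omega, by omega, by omega, Or.inr ?_⟩
      push_cast
      linear_combination -h
    · subst hbb
      have h1 : ((x + 1 : ℕ) : ZMod p) * m = 0 := by push_cast; linear_combination -h
      exact (mul_ne_zero (hcast (x + 1) (by omega) (by omega)) hm) h1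
    · obtain ⟨y, rfl⟩ := Nat.exists_eq_add_of_lt hbb
      push_cast at h
      refine hmS ⟨hm, x + 1, y + 1, by omega, by omega, by omega, by omega, Or.inl ?_⟩
      push_cast
      linear_combination -h
  have hinj : ∀ m : ZMod p, m ≠ 0 → m ∉ S →
      Set.InjOn (fun q : ℕ × ℕ => (q.2 : ZMod p) - q.1 * m)
      (Finset.range (α + 1) ×ˢ Finset.range (β + 1) : Finset (ℕ × ℕ)) := by
    rintro m hm hmS ⟨a, b⟩ h1 ⟨a', b'⟩ h2 h
    rw [Finset.mem_coe, Finset.mem_product, Finset.mem_range, Finset.mem_range] at h1 h2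
    simp only at h1 h2 h
    rcases lt_trichotomy a a' with haa | haa | haa
    · exact (key m hm hmS a' a b' b haa (by omega) (by omega) (by omega) h.symm).elim
    · subst haa
      have h3 : (b : ZMod p) = b' := by linear_combination h
      rw [ZMod.natCast_eq_natCast_iff', Nat.mod_eq_of_lt (by omega),
        Nat.mod_eq_of_lt (by omega)] at h3
      rw [h3]
    · exact (key m hm hmS a a' b b' haa (by omega) (by omega) (by omega) h).elim
  set M : Finset (ZMod p) := Finset.univ.filter (fun m => m ≠ 0 ∧ m ∉ S) with hMdef
  have hsum : S.ncard + M.card + 1 = p := by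
    have e1 : S.ncard = (Finset.univ.filter (fun m => m ∈ S)).card := by
      rw [← Set.ncard_coe_finset]; congr 1; ext; simp
    have e2 : M = (Finset.univ.filter (fun m => ¬ m ∈ S)).erase 0 := by
      ext m; simp [hMdef]
    have h0 : (0 : ZMod p) ∈ Finset.univ.filter (fun m => ¬ m ∈ S) := by
      simp [hS]
    have e3 := Finset.card_erase_add_one h0
    have e4 := Finset.card_filter_add_card_filter_not (s := (Finset.univ : Finset (ZMod p)))
      (fun m => m ∈ S)
    rw [Finset.card_univ, ZMod.card] at e4
    rw [e1, e2]
    omega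
  rcases M.eq_empty_or_nonempty with hE | ⟨m, hm⟩
  · rw [hE, Finset.card_empty] at hsum
    omega
  · have hMi : ∀ m ∈ M, Set.InjOn (fun q : ℕ × ℕ => (q.2 : ZMod p) - q.1 * m)
        (Finset.range (α + 1) ×ˢ Finset.range (β + 1) : Finset (ℕ × ℕ)) := by
      intro m hm
      rw [hMdef, Finset.mem_filter] at hm
      exact hinj m hm.2.1 hm.2.2
    have hnp : (α + 1) * (β + 1) ≤ p := by
      have := Finset.card_le_card_of_injOn (t := (Finset.univ : Finset (ZMod p))) _
        (fun _ _ => Finset.mem_univ _) (hMi m hm)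
      simpa [ZMod.card] using this
    have := tv_core p α β hα hβ hβp hnp M hMi
    omega
end

section
/- Let p be a prime, let α, β be positive natural numbers with α·(β+1) ≤ p-1, and let μ, ν be natural numbers with p not dividing μ·ν. Then the set of residues a ∈ 𝔽_p \ {0} for which there exist x ∈ {μ, 2μ, …, αμ} and y ∈ {ν, 2ν, …, βν} such that a·x ≡ y (mod p) or a·x ≡ -y (mod p) has at least α·(β+1) elements. -/
open Polynomial in
/-- total degree at most `m` for polynomials in `F[y][X]`. -/
def TVTotDeg {F : Type*} [Field F] (m : ℕ) (f : F[X][X]) : Prop :=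
  ∀ k d : ℕ, m < k + d → (f.coeff k).coeff d = 0

namespace TV
open Polynomial

variable {F : Type*} [Field F]

lemma td_mul {m n : ℕ} {f g : F[X][X]} (hf : TVTotDeg m f) (hg : TVTotDeg n g) :
    TVTotDeg (m + n) (f * g) := by
  intro k d h
  rw [coeff_mul, finsetSum_coeff]
  refine Finset.sum_eq_zero fun x hx => ?_
  rw [coeff_mul]
  refine Finset.sum_eq_zero fun z hz => ?_
  rw [Finset.HasAntidiagonal.mem_antidiagonal] at hx hz
  by_cases h1 : m < x.1 + z.1
  · rw [hf _ _ h1, zero_mul]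
  · rw [hg x.2 z.2 (by omega), mul_zero]

lemma td_sub {m : ℕ} {f g : F[X][X]} (hf : TVTotDeg m f) (hg : TVTotDeg m g) :
    TVTotDeg m (f - g) := by
  intro k d h
  rw [coeff_sub, coeff_sub, hf _ _ h, hg _ _ h, sub_zero]

lemma td_X : TVTotDeg 1 (X : F[X][X]) := by
  intro k d h
  rw [coeff_X]
  split_ifs with h1
  · rw [coeff_one, if_neg (by omega)]
  · simp

lemma td_one : TVTotDeg 0 (1 : F[X][X]) := by
  intro k d h
  rw [coeff_one]
  split_ifs with h1
  · rw [coeff_one, if_neg (by omega)]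
  · simp

lemma td_linear (a b : F) : TVTotDeg 1 (X - C (C b - C a * X) : F[X][X]) := by
  apply td_sub td_X
  intro k d h
  rw [coeff_C]
  split_ifs with h1
  · rw [coeff_sub, coeff_C, coeff_C_mul, coeff_X, if_neg (by omega), if_neg (by omega)]
    simp
  · simp

lemma td_prod {ι : Type*} (s : Finset ι) (f : ι → F[X][X]) (h : ∀ i ∈ s, TVTotDeg 1 (f i)) :
    TVTotDeg s.card (∏ i ∈ s, f i) := by
  classical
  induction s using Finset.induction_on with
  | empty => simpa using td_one
  | insert a s ha ih =>
    rw [Finset.prod_insert ha, Finset.card_insert_of_notMem ha, add_comm]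
    exact td_mul (h a (by simp)) (ih fun i hi => h i (by simp [hi]))

lemma exists_rem {n : ℕ} (hn : 0 < n) {H : F[X][X]} (hm : H.Monic) (hd : H.natDegree = n)
    (ht : TVTotDeg n H) (m : ℕ) :
    ∃ r : F[X][X], TVTotDeg m r ∧ r.degree < n ∧ H ∣ X ^ m - r := by
  induction m with
  | zero =>
    exact ⟨1, td_one, by rw [degree_one]; exact_mod_cast hn, by simp⟩
  | succ m ih =>
    obtain ⟨r, h1, h2, h3⟩ := ih
    have hc : TVTotDeg (m + 1 - n) (C (r.coeff (n - 1))) := by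
      intro k d h
      rw [coeff_C]
      split_ifs with h1'
      · exact h1 _ _ (by omega)
      · simp
    have htX : TVTotDeg (m + 1) (r * X) := td_mul h1 td_X
    have htC : TVTotDeg (m + 1) (C (r.coeff (n - 1)) * H) := by
      by_cases hmn : n ≤ m + 1
      · have := td_mul hc ht
        rwa [Nat.sub_add_cancel hmn] at this
      · have : r.coeff (n - 1) = 0 := by
          ext d
          exact h1 _ _ (by omega)
        rw [this]
        intro k d h
        simp
    refine ⟨r * X - C (r.coeff (n - 1)) * H, td_sub htX htC, ?_, ?_⟩
    · rw [degree_lt_iff_coeff_zero] at h2 ⊢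
      intro k hk
      obtain ⟨k, rfl⟩ : ∃ k', k = k' + 1 := ⟨k - 1, by omega⟩
      rw [coeff_sub, coeff_mul_X, coeff_C_mul]
      rcases hk.eq_or_lt with h | h
      · have : H.coeff (k + 1) = 1 := by rw [← h, ← hd]; exact hm
        rw [this, h]; simp
      · rw [h2 k (by omega), coeff_eq_zero_of_natDegree_lt (p := H) (by omega)]; simp
    · have : (X ^ (m + 1) - (r * X - C (r.coeff (n - 1)) * H) : F[X][X])
          = (X ^ m - r) * X + C (r.coeff (n - 1)) * H := by ring
      rw [this]
      exact dvd_add (Dvd.dvd.mul_right h3 _) (Dvd.intro_left _ rfl)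

lemma const_of_derivative (p : ℕ) [Fact p.Prime] (g : (ZMod p)[X]) (hgp : g.natDegree < p)
    (hg0 : derivative g = 0) : g = C (g.coeff 0) := by
  ext k
  rw [coeff_C]
  split_ifs with h
  · rw [h]
  · by_cases hk : k < p
    · obtain ⟨k, rfl⟩ : ∃ k', k = k' + 1 := ⟨k - 1, by omega⟩
      have h2 := congrArg (fun f => coeff f k) hg0
      simp only [coeff_derivative, coeff_zero] at h2
      have h3 : ((k + 1 : ℕ) : ZMod p) ≠ 0 := by
        rw [Ne, ZMod.natCast_eq_zero_iff]
        exact Nat.not_dvd_of_pos_of_lt (by omega) hk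
      rw [← Nat.cast_succ] at h2
      exact (mul_eq_zero.mp h2).resolve_right h3
    · exact coeff_eq_zero_of_natDegree_lt (by omega)

/-- The Redei polynomial argument. -/
lemma redei (p : ℕ) [Fact p.Prime] (A B : Finset (ZMod p)) (S : Finset (ZMod p))
    (hA : 1 < A.card) (hB : 1 < B.card) (hne : S.Nonempty) (h0 : 0 ∉ S)
    (hS : ∀ y ∈ S, Set.InjOn (fun z : ZMod p × ZMod p => z.2 - z.1 * y) (A ×ˢ B : Finset _)) :
    (A.card - 1) * B.card + S.card ≤ p - 1 := by
  classical
  have hp : p.Prime := Fact.out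
  set n := (A ×ˢ B).card with hn
  have hnc : n = A.card * B.card := Finset.card_product _ _
  have hn2 : 1 < n := by nlinarith
  have hnp : n ≤ p := by
    obtain ⟨y, hy⟩ := hne
    have := Finset.card_image_of_injOn (hS y hy)
    rw [hn, ← this]
    exact (Finset.card_le_univ _).trans (by rw [ZMod.card])
  have hSp : S.card ≤ p - 1 := by
    have h : S ⊆ Finset.univ.erase 0 := fun x hx => by
      simp only [Finset.mem_erase, Finset.mem_univ, and_true]
      rintro rfl; exact h0 hx
    have := Finset.card_le_card h
    rwa [Finset.card_erase_of_mem (Finset.mem_univ _), Finset.card_univ, ZMod.card] at this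
  set H : (ZMod p)[X][X] := ∏ z ∈ A ×ˢ B, (X - C (C z.2 - C z.1 * X)) with hH
  have hm : H.Monic := monic_prod_of_monic _ _ fun z _ => monic_X_sub_C _
  have hd : H.natDegree = n := by
    rw [hH, natDegree_prod_of_monic _ _ fun z _ => monic_X_sub_C _]
    simp only [natDegree_X_sub_C, Finset.sum_const, smul_eq_mul, mul_one, hn]
  have ht : TVTotDeg n H := td_prod _ _ fun z _ => td_linear _ _
  obtain ⟨r, hr1, hr2, hr3⟩ := exists_rem (by omega) hm hd ht p
  have hmap : ∀ y : ZMod p, H.map (evalRingHom y) = ∏ z ∈ A ×ˢ B, (X - C (z.2 - z.1 * y)) := by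
    intro y
    rw [hH, Polynomial.map_prod]
    simp
  have hdvd : ∀ y : ZMod p, H.map (evalRingHom y) ∣ X ^ p - r.map (evalRingHom y) := by
    intro y
    have := Polynomial.map_dvd (evalRingHom y) hr3
    simpa using this
  have hrdeg : ∀ y : ZMod p, (r.map (evalRingHom y)).degree < n := fun y =>
    lt_of_le_of_lt degree_map_le hr2
  have hrX : ∀ y ∈ S, r.map (evalRingHom y) = X := by
    intro y hy
    have h1 : H.map (evalRingHom y) ∣ X ^ p - X := by
      rw [hmap]
      apply Finset.prod_dvd_of_coprime
      · intro z hz w hw hzw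
        apply isCoprime_X_sub_C_of_isUnit_sub
        rw [isUnit_iff_ne_zero, sub_ne_zero]
        exact fun h => hzw (hS y hy hz hw h)
      · intro z _
        rw [dvd_iff_isRoot]
        simp [ZMod.pow_card]
    have h2 : H.map (evalRingHom y) ∣ r.map (evalRingHom y) - X := by
      have := dvd_sub h1 (hdvd y)
      simpa using this
    by_contra hcon
    have h3 := degree_le_of_dvd h2 (sub_ne_zero.mpr hcon)
    rw [hm.degree_map, degree_eq_natDegree hm.ne_zero, hd] at h3
    have h4 : (r.map (evalRingHom y) - X).degree < (n : WithBot ℕ) := by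
      refine lt_of_le_of_lt (degree_sub_le _ _) (max_lt (hrdeg y) ?_)
      rw [degree_X]; exact_mod_cast hn2
    exact absurd h3 (not_le.mpr h4)
  have hcoeff : ∀ k, p - S.card < k → r.coeff k = 0 := by
    intro k hk
    by_cases hkp : p < k
    · ext d
      exact hr1 _ _ (by omega)
    have hnd : (r.coeff k).natDegree ≤ p - k := by
      rw [natDegree_le_iff_coeff_eq_zero]
      intro d hd'
      exact hr1 _ _ (by omega)
    apply eq_zero_of_natDegree_lt_card_of_eval_eq_zero' _ S
    · intro y hy
      have := congrArg (fun f => coeff f k) (hrX y hy)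
      simp only [coeff_map, coe_evalRingHom, coeff_X] at this
      rw [this, if_neg (by omega)]
    · omega
  set g := r.map (evalRingHom (0 : ZMod p)) with hg
  have hgd : g.natDegree ≤ p - S.card := by
    rw [natDegree_le_iff_coeff_eq_zero]
    intro k hk
    rw [hg, coeff_map, hcoeff k hk, map_zero]
  have hH0 : H.map (evalRingHom (0 : ZMod p)) = (∏ b ∈ B, (X - C b)) ^ A.card := by
    rw [hmap, Finset.prod_product]
    simp
  have hdv := hdvd 0
  rw [hH0, ← hg] at hdv
  have hder : (∏ b ∈ B, (X - C b)) ^ (A.card - 1) ∣ derivative g := by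
    obtain ⟨q, hq⟩ := hdv
    have h1 : derivative g = - derivative ((∏ b ∈ B, (X - C b)) ^ A.card * q) := by
      rw [← hq, derivative_sub, derivative_X_pow, CharP.cast_eq_zero]; simp
    rw [h1, dvd_neg, derivative_mul, derivative_pow]
    apply dvd_add
    · exact ⟨C (A.card : ZMod p) * derivative (∏ b ∈ B, (X - C b)) * q, by ring⟩
    · exact Dvd.dvd.mul_right (pow_dvd_pow _ (by omega)) _
  by_cases hg0 : derivative g = 0
  · exfalso
    have hgp : g.natDegree < p := by
      by_cases h : g = 0
      · rw [h]; simpa using hp.pos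
      · have := hrdeg 0
        rw [← hg, degree_eq_natDegree h] at this
        have : g.natDegree < n := by exact_mod_cast this
        omega
    have hroot : ∀ b ∈ B, b = g.coeff 0 := by
      intro b hb
      have h1 : (X - C b) ∣ X ^ p - g :=
        ((Finset.dvd_prod_of_mem (fun b => (X - C b : (ZMod p)[X])) hb).trans (dvd_pow_self _ (by omega))).trans hdv
      have hgc := const_of_derivative p g hgp hg0
      rw [dvd_iff_isRoot, IsRoot, eval_sub, hgc] at h1
      rw [eval_pow, eval_X, eval_C, ZMod.pow_card] at h1
      exact sub_eq_zero.mp h1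
    obtain ⟨b, hb, c, hc, hbc⟩ := Finset.one_lt_card.mp hB
    exact hbc ((hroot b hb).trans (hroot c hc).symm)
  · have h1 := natDegree_le_of_dvd hder hg0
    rw [natDegree_pow, natDegree_prod_of_monic _ _ fun z _ => monic_X_sub_C _] at h1
    simp only [natDegree_X_sub_C, Finset.sum_const, smul_eq_mul, mul_one] at h1
    have h2 : (derivative g).natDegree < g.natDegree := by
      apply natDegree_derivative_lt
      intro h
      apply hg0
      rw [eq_C_of_natDegree_eq_zero h]; simp
    omega

end TV

/-- Dilated version of the main theorem: with `x` ranging over `{μ, 2μ, …, αμ}`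
and `y` over `{ν, 2ν, …, βν}`, where `p ∤ μν`, there are at least `α(β+1)`
nonzero residues `a` mod `p` with `a·x ≡ ±y (mod p)`. -/
theorem thue_vinogradov_extension_dilated (p : ℕ) [Fact p.Prime] (α β : ℕ)
    (hα : 0 < α) (hβ : 0 < β) (hαβ : α * (β + 1) ≤ p - 1)
    (μ ν : ℕ) (hμν : ¬ p ∣ μ * ν) :
    α * (β + 1) ≤
      Set.ncard {a : ZMod p | a ≠ 0 ∧ ∃ x y : ℕ,
        (∃ i : ℕ, 1 ≤ i ∧ i ≤ α ∧ x = i * μ) ∧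
        (∃ j : ℕ, 1 ≤ j ∧ j ≤ β ∧ y = j * ν) ∧
        (a * (x : ZMod p) = (y : ZMod p) ∨ a * (x : ZMod p) = -(y : ZMod p))} := by
  classical
  have hp : p.Prime := Fact.out
  set T : Set (ZMod p) := {a : ZMod p | a ≠ 0 ∧ ∃ x y : ℕ,
        (∃ i : ℕ, 1 ≤ i ∧ i ≤ α ∧ x = i * μ) ∧
        (∃ j : ℕ, 1 ≤ j ∧ j ≤ β ∧ y = j * ν) ∧
        (a * (x : ZMod p) = (y : ZMod p) ∨ a * (x : ZMod p) = -(y : ZMod p))} with hT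
  have hαp : α < p := by have := hp.pos; nlinarith [Nat.sub_add_cancel hp.pos]
  have hβp : β < p := by have := hp.pos; nlinarith [Nat.sub_add_cancel hp.pos]
  have hμ : (μ : ZMod p) ≠ 0 := by
    rw [Ne, ZMod.natCast_eq_zero_iff]; exact fun h => hμν (Dvd.dvd.mul_right h _)
  have hν : (ν : ZMod p) ≠ 0 := by
    rw [Ne, ZMod.natCast_eq_zero_iff]; exact fun h => hμν (Dvd.dvd.mul_left h _)
  have hcast : ∀ i j : ℕ, i < p → j < p → (i : ZMod p) = j → i = j := by
    intro i j hi hj h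
    rw [ZMod.natCast_eq_natCast_iff'] at h
    rwa [Nat.mod_eq_of_lt hi, Nat.mod_eq_of_lt hj] at h
  set A : Finset (ZMod p) := (Finset.range (α + 1)).image fun i : ℕ => (i : ZMod p) * μ with hA
  set B : Finset (ZMod p) := (Finset.range (β + 1)).image fun i : ℕ => (i : ZMod p) * ν with hB
  have hAc : A.card = α + 1 := by
    rw [hA, Finset.card_image_of_injOn, Finset.card_range]
    intro i hi j hj h
    simp only [Finset.coe_range, Set.mem_Iio] at hi hj
    exact hcast i j (by omega) (by omega) (mul_right_cancel₀ hμ h)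
  have hBc : B.card = β + 1 := by
    rw [hB, Finset.card_image_of_injOn, Finset.card_range]
    intro i hi j hj h
    simp only [Finset.coe_range, Set.mem_Iio] at hi hj
    exact hcast i j (by omega) (by omega) (mul_right_cancel₀ hν h)
  set S : Finset (ZMod p) := Finset.univ.filter fun a => a ≠ 0 ∧ a ∉ T with hS
  have hcount : p - 1 = T.ncard + S.card := by
    have h1 : T.ncard = (Finset.univ.filter fun a => a ∈ T).card := by
      rw [← Set.ncard_coe_finset]; congr 1; ext; simp
    have h2 : (Finset.univ.erase (0 : ZMod p)) = (Finset.univ.filter fun a => a ∈ T) ∪ S := by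
      ext a
      simp only [Finset.mem_erase, Finset.mem_univ, and_true, Finset.mem_union, hS,
        Finset.mem_filter, true_and]
      constructor
      · intro h; by_cases h' : a ∈ T
        · exact Or.inl h'
        · exact Or.inr ⟨h, h'⟩
      · rintro (h | h)
        · exact h.1
        · exact h.1
    have h3 : (Finset.univ.erase (0 : ZMod p)).card = p - 1 := by
      rw [Finset.card_erase_of_mem (Finset.mem_univ _), Finset.card_univ, ZMod.card]
    rw [← h3, h2, h1, Finset.card_union_of_disjoint]
    rw [Finset.disjoint_left]
    intro a ha hb
    simp only [hS, Finset.mem_filter, Finset.mem_univ, true_and] at ha hb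
    exact hb.2 ha
  rcases S.eq_empty_or_nonempty with hSe | hSn
  · rw [hSe, Finset.card_empty] at hcount
    omega
  -- key: asymmetric injectivity
  have key : ∀ y ∈ S, ∀ i i' j j' : ℕ, i' < i → i ≤ α → j ≤ β → j' ≤ β →
      (j : ZMod p) * ν - i * μ * y = j' * ν - i' * μ * y → False := by
    intro y hy i i' j j' hi hiα hj hj' h
    simp only [hS, Finset.mem_filter, Finset.mem_univ, true_and] at hy
    have e : y * (((i - i') * μ : ℕ) : ZMod p) = j * ν - j' * ν := by
      push_cast [Nat.cast_sub hi.le]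
      linear_combination -h
    rcases lt_trichotomy j j' with hl | hl | hl
    · refine hy.2 ⟨hy.1, _, (j' - j) * ν, ⟨i - i', by omega, by omega, rfl⟩,
        ⟨j' - j, by omega, by omega, rfl⟩, Or.inr ?_⟩
      rw [e]; push_cast [Nat.cast_sub hl.le]; ring
    · rw [hl, sub_self, Nat.cast_mul] at e
      rcases mul_eq_zero.mp e with h1 | h1
      · exact hy.1 h1
      · rcases mul_eq_zero.mp h1 with h2 | h2
        · have := hcast (i - i') 0 (by omega) hp.pos (by rw [h2]; simp)
          omega
        · exact hμ h2
    · refine hy.2 ⟨hy.1, _, (j - j') * ν, ⟨i - i', by omega, by omega, rfl⟩,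
        ⟨j - j', by omega, by omega, rfl⟩, Or.inl ?_⟩
      rw [e]; push_cast [Nat.cast_sub hl.le]; ring
  have := TV.redei p A B S (by omega) (by omega) hSn (by simp [hS]) (by
    rintro y hy ⟨a, b⟩ hz ⟨a', b'⟩ hw h
    simp only [Finset.coe_product, Set.mem_prod, Finset.mem_coe, hA, hB, Finset.mem_image,
      Finset.mem_range] at hz hw
    obtain ⟨⟨i, hi, rfl⟩, ⟨j, hj, rfl⟩⟩ := hz
    obtain ⟨⟨i', hi', rfl⟩, ⟨j', hj', rfl⟩⟩ := hw
    simp only at h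
    rcases lt_trichotomy i i' with hl | hl | hl
    · exact (key y hy i' i j' j hl (by omega) (by omega) (by omega) h.symm).elim
    · subst hl
      have : (j : ZMod p) * ν = j' * ν := by linear_combination h
      rw [this]
    · exact (key y hy i i' j j' hl (by omega) (by omega) (by omega) h).elim)
  rw [hAc, hBc, Nat.add_sub_cancel] at this
  omega
end
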